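/- Let (𝒫, 𝒩) be a Beurling generalized number system whose integers are θ-well-behaved for some θ ∈ [0,1), and let k > 0 with 2k a positive integer. Then there are constants C₂ and C (depending on k and the system) such that for all large T, uniformly for |t| ≤ T and with Z = C₂ log T, |ζ_𝒫((1+θ)/2 + 1/log T + it)|^{2k} ≤ C (1 + log T · ∫_{−Z/2}^{Z/2} |ζ_𝒫((1+θ)/2 + it + iv)|^{2k} e^{−|v|} dv). -/

import Mathlib

open Filter Asymptotics

/-- A Beurling generalized number system: a nondecreasing sequence of generalized
primes `p` with `1 < p 0` tending to infinity, together with the nondecreasing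
enumeration `n` (with multiplicity) of all finite products of the generalized primes,
witnessed by the bijection `equiv` from exponent vectors to indices. -/
structure BeurlingSystem where
  p : ℕ → ℝ
  n : ℕ → ℝ
  one_lt_p : 1 < p 0
  mono_p : Monotone p
  tendsto_p : Tendsto p atTop atTop
  mono_n : Monotone n
  equiv : (ℕ →₀ ℕ) ≃ ℕ
  n_eq : ∀ k : ℕ →₀ ℕ, n (equiv k) = ∏ j ∈ k.support, p j ^ k j

/-- The integer counting function `N_𝒫(x)`. -/
noncomputable def BeurlingSystem.Nint (S : BeurlingSystem) (x : ℝ) : ℕ :=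
  {j : ℕ | S.n j ≤ x}.ncard

/-- `Z` is an analytic continuation of the Beurling zeta function of the system `S`
to the half-plane `Re s > θ`, with density `A`: it agrees with the Dirichlet series
on `Re s > 1` and `Z s - A/(s-1)` is analytic on `Re s > θ`. -/
def BeurlingSystem.IsZeta (S : BeurlingSystem) (θ A : ℝ) (Z : ℂ → ℂ) : Prop :=
  (∀ s : ℂ, 1 < s.re → Z s = ∑' j : ℕ, (S.n j : ℂ) ^ (-s)) ∧
    DifferentiableOn ℂ (fun s => Z s - (A : ℂ) / (s - 1)) {s : ℂ | θ < s.re}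

/-- The number of zeros (without multiplicity) of `Z` with `α ≤ Re ρ` and `|Im ρ| ≤ T`. -/
noncomputable def zeroCount (Z : ℂ → ℂ) (α T : ℝ) : ℕ :=
  {ρ : ℂ | Z ρ = 0 ∧ α ≤ ρ.re ∧ |ρ.im| ≤ T}.ncard

open Complex in
/-- The integral of `1 / w` around the rectangle has norm bounded below. -/
lemma rect_inv_integral_lower {δ V : ℝ} (hδ : 0 < δ) (hV : 1 ≤ V) :
    4 / 5 ≤ ‖(∫ x in -δ..2, ((x : ℂ) + ((-V : ℝ) : ℂ) * I)⁻¹)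
      - (∫ x in -δ..2, ((x : ℂ) + (V : ℂ) * I)⁻¹)
      + I • (∫ y in -V..V, (((2 : ℝ) : ℂ) + (y : ℂ) * I)⁻¹)
      - I • (∫ y in -V..V, (((-δ : ℝ) : ℂ) + (y : ℂ) * I)⁻¹)‖ := by
  have hV0 : V ≠ 0 := by positivity
  have hor : ∀ c : ℝ, c ≠ 0 → Continuous fun x : ℝ => ((x : ℂ) + (c : ℂ) * I)⁻¹ := by
    intro c hc
    refine Continuous.inv₀ (by fun_prop) fun x h => hc ?_
    simpa using congrArg Complex.im h
  have ver : ∀ c : ℝ, c ≠ 0 → Continuous fun y : ℝ => ((c : ℂ) + (y : ℂ) * I)⁻¹ := by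
    intro c hc
    refine Continuous.inv₀ (by fun_prop) fun x h => hc ?_
    simpa using congrArg Complex.re h
  have im_hor : ∀ c : ℝ, c ≠ 0 → (∫ x in -δ..2, ((x : ℂ) + (c : ℂ) * I)⁻¹).im
      = -c * ∫ x in -δ..2, (x ^ 2 + c ^ 2)⁻¹ := by
    intro c hc
    have := Complex.imCLM.intervalIntegral_comp_comm
      ((hor c hc).intervalIntegrable (μ := MeasureTheory.volume) (-δ) 2)
    rw [Complex.imCLM_apply] at this
    rw [← this, ← intervalIntegral.integral_const_mul]
    refine intervalIntegral.integral_congr fun x _ => ?_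
    simp [Complex.inv_im, Complex.normSq_apply, pow_two, div_eq_mul_inv]
  have re_ver : ∀ c : ℝ, c ≠ 0 → (∫ y in -V..V, ((c : ℂ) + (y : ℂ) * I)⁻¹).re
      = c * ∫ y in -V..V, (c ^ 2 + y ^ 2)⁻¹ := by
    intro c hc
    have := Complex.reCLM.intervalIntegral_comp_comm
      ((ver c hc).intervalIntegrable (μ := MeasureTheory.volume) (-V) V)
    rw [Complex.reCLM_apply] at this
    rw [← this, ← intervalIntegral.integral_const_mul]
    refine intervalIntegral.integral_congr fun x _ => ?_
    simp [Complex.inv_re, Complex.normSq_apply, pow_two, div_eq_mul_inv]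
  refine le_trans ?_ (Complex.abs_im_le_norm _)
  refine le_trans ?_ (le_abs_self _)
  simp only [Complex.sub_im, Complex.add_im, smul_eq_mul, Complex.I_mul_im]
  rw [im_hor (-V) (neg_ne_zero.2 hV0), im_hor V hV0, re_ver 2 two_ne_zero,
    re_ver (-δ) (neg_ne_zero.2 hδ.ne')]
  have hor_nonneg : ∀ c : ℝ, 0 ≤ ∫ x in -δ..2, (x ^ 2 + c ^ 2)⁻¹ := fun c =>
    intervalIntegral.integral_nonneg (by linarith) fun x _ => by positivity
  have ver_nonneg : 0 ≤ ∫ y in -V..V, ((-δ) ^ 2 + y ^ 2)⁻¹ :=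
    intervalIntegral.integral_nonneg (by linarith) fun x _ => by positivity
  have h1 := mul_nonneg (zero_le_one.trans hV) (hor_nonneg (-V))
  have h2 := mul_nonneg (zero_le_one.trans hV) (hor_nonneg V)
  have h3 := mul_nonneg hδ.le ver_nonneg
  have hc : Continuous fun y : ℝ => ((2 : ℝ) ^ 2 + y ^ 2)⁻¹ :=
    Continuous.inv₀ (by fun_prop) fun y => by positivity
  have h4 : ∫ y in (-1 : ℝ)..1, (1 / 5 : ℝ) ≤ ∫ y in (-1 : ℝ)..1, ((2 : ℝ) ^ 2 + y ^ 2)⁻¹ := by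
    refine intervalIntegral.integral_mono_on (by norm_num) (by simp)
      (hc.intervalIntegrable _ _) fun y hy => ?_
    rw [one_div]
    refine inv_anti₀ (by positivity) ?_
    nlinarith [hy.1, hy.2]
  have h5 : ∫ y in (-1 : ℝ)..1, ((2 : ℝ) ^ 2 + y ^ 2)⁻¹ ≤ ∫ y in -V..V, ((2 : ℝ) ^ 2 + y ^ 2)⁻¹ :=
    intervalIntegral.integral_mono_interval (by linarith) (by norm_num) hV
      (Eventually.of_forall fun y => by positivity) (hc.intervalIntegrable _ _)
  rw [intervalIntegral.integral_const, smul_eq_mul] at h4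
  linarith

open Complex in
/-- A Cauchy type estimate on a rectangle around the origin. -/
lemma norm_le_rect_integrals {Ψ : ℂ → ℂ} {U : Set ℂ} (hU : IsOpen U) (hΨ : DifferentiableOn ℂ Ψ U)
    {δ V : ℝ} (hδ : 0 < δ) (hV : 1 ≤ V) (hsub : {w : ℂ | -δ ≤ w.re} ⊆ U) :
    4 / 5 * ‖Ψ 0‖ ≤ (∫ x in -δ..2, ‖Ψ ((x : ℂ) + ((-V : ℝ) : ℂ) * I)‖)
      + (∫ x in -δ..2, ‖Ψ ((x : ℂ) + (V : ℂ) * I)‖)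
      + (∫ y in -V..V, ‖Ψ (((2 : ℝ) : ℂ) + (y : ℂ) * I)‖)
      + δ⁻¹ * ∫ y in -V..V, ‖Ψ (((-δ : ℝ) : ℂ) + (y : ℂ) * I)‖ := by
  have hV0 : V ≠ 0 := by positivity
  have h0U : (0 : ℂ) ∈ U := hsub (by simp [hδ.le])
  have hds : DifferentiableOn ℂ (dslope Ψ 0) U :=
    (Complex.differentiableOn_dslope (hU.mem_nhds h0U)).2 hΨ
  have key := Complex.integral_boundary_rect_eq_zero_of_differentiableOn (dslope Ψ 0)
    ⟨-δ, -V⟩ ⟨2, V⟩ (hds.mono (by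
      intro w hw
      refine hsub ?_
      have := hw.1
      simp only [Set.mem_preimage] at this
      rw [Set.uIcc_of_le (by linarith)] at this
      exact this.1))
  simp only at key
  have edge : ∀ (a b : ℝ) (γ : ℝ → ℂ), a ≤ b → Continuous γ → (∀ x ∈ Set.Icc a b, -δ ≤ (γ x).re) →
      (∀ x, γ x ≠ 0) → ∀ M : ℝ, (∀ x, ‖(γ x)⁻¹‖ ≤ M) →
      ∃ E : ℂ, (∫ x in a..b, dslope Ψ 0 (γ x)) = E - Ψ 0 * ∫ x in a..b, (γ x)⁻¹ ∧
        ‖E‖ ≤ M * ∫ x in a..b, ‖Ψ (γ x)‖ := by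
    intro a b γ hab hγ hre hne M hM
    have hci : Continuous fun x => (γ x)⁻¹ := hγ.inv₀ hne
    have hcΨ : ContinuousOn (fun x => Ψ (γ x)) (Set.uIcc a b) := by
      rw [Set.uIcc_of_le hab]
      exact hΨ.continuousOn.comp hγ.continuousOn fun x hx => hsub (hre x hx)
    have hc1 : ContinuousOn (fun x => (γ x)⁻¹ * Ψ (γ x)) (Set.uIcc a b) :=
      hci.continuousOn.mul hcΨ
    refine ⟨∫ x in a..b, (γ x)⁻¹ * Ψ (γ x), ?_, ?_⟩
    · rw [← intervalIntegral.integral_const_mul, ← intervalIntegral.integral_sub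
        hc1.intervalIntegrable ((hci.const_mul _).intervalIntegrable _ _)]
      refine intervalIntegral.integral_congr fun x _ => ?_
      simp only [dslope_of_ne _ (hne x), slope_def_field, sub_zero]
      rw [div_eq_inv_mul]; ring
    · rw [← intervalIntegral.integral_const_mul]
      refine intervalIntegral.norm_integral_le_of_norm_le hab ?_
        (hcΨ.norm.intervalIntegrable.const_mul _)
      refine Eventually.of_forall fun x _ => ?_
      rw [norm_mul]
      exact mul_le_mul_of_nonneg_right (hM x) (norm_nonneg _)
  have inv_im : ∀ c : ℝ, 1 ≤ |c| → ∀ x : ℝ, ‖((x : ℂ) + (c : ℂ) * I)⁻¹‖ ≤ 1 := by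
    intro c hc x
    rw [norm_inv]
    refine inv_le_one_of_one_le₀ (hc.trans ?_)
    simpa using Complex.abs_im_le_norm ((x : ℂ) + (c : ℂ) * I)
  have inv_re : ∀ c : ℝ, c ≠ 0 → ∀ y : ℝ, ‖((c : ℂ) + (y : ℂ) * I)⁻¹‖ ≤ |c|⁻¹ := by
    intro c hc y
    rw [norm_inv]
    refine inv_anti₀ (abs_pos.2 hc) ?_
    simpa using Complex.abs_re_le_norm ((c : ℂ) + (y : ℂ) * I)
  have ne_hor : ∀ c : ℝ, c ≠ 0 → ∀ x : ℝ, (x : ℂ) + (c : ℂ) * I ≠ 0 := fun c hc x h =>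
    hc (by simpa using congrArg Complex.im h)
  have ne_ver : ∀ c : ℝ, c ≠ 0 → ∀ x : ℝ, (c : ℂ) + (x : ℂ) * I ≠ 0 := fun c hc x h =>
    hc (by simpa using congrArg Complex.re h)
  obtain ⟨E₁, h₁, b₁⟩ := edge (-δ) 2 (fun x => (x : ℂ) + ((-V : ℝ) : ℂ) * I) (by linarith)
    (by fun_prop) (fun x hx => by simpa using hx.1) (ne_hor _ (neg_ne_zero.2 hV0)) 1
    (inv_im _ (by rw [abs_neg]; exact hV.trans (le_abs_self _)))
  obtain ⟨E₂, h₂, b₂⟩ := edge (-δ) 2 (fun x => (x : ℂ) + (V : ℂ) * I) (by linarith)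
    (by fun_prop) (fun x hx => by simpa using hx.1) (ne_hor _ hV0) 1
    (inv_im _ (hV.trans (le_abs_self _)))
  obtain ⟨E₃, h₃, b₃⟩ := edge (-V) V (fun y => ((2 : ℝ) : ℂ) + (y : ℂ) * I) (by linarith)
    (by fun_prop) (fun x hx => by simp; linarith) (ne_ver _ two_ne_zero) 1
    (fun y => (inv_re 2 two_ne_zero y).trans (by norm_num))
  obtain ⟨E₄, h₄, b₄⟩ := edge (-V) V (fun y => ((-δ : ℝ) : ℂ) + (y : ℂ) * I) (by linarith)
    (by fun_prop) (fun x hx => by simp) (ne_ver _ (neg_ne_zero.2 hδ.ne')) δ⁻¹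
    (fun y => (inv_re (-δ) (neg_ne_zero.2 hδ.ne') y).trans (by rw [abs_neg, abs_of_pos hδ]))
  rw [h₁, h₂, h₃, h₄] at key
  have low := rect_inv_integral_lower hδ hV
  simp only [smul_eq_mul] at key low
  set J := (∫ x in -δ..2, ((x : ℂ) + ((-V : ℝ) : ℂ) * I)⁻¹)
      - (∫ x in -δ..2, ((x : ℂ) + (V : ℂ) * I)⁻¹)
      + I * (∫ y in -V..V, (((2 : ℝ) : ℂ) + (y : ℂ) * I)⁻¹)
      - I * (∫ y in -V..V, (((-δ : ℝ) : ℂ) + (y : ℂ) * I)⁻¹) with hJ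
  have hEJ : Ψ 0 * J = E₁ - E₂ + I * E₃ - I * E₄ := by
    rw [hJ]; linear_combination -key
  have hn : ‖Ψ 0‖ * ‖J‖ ≤ ‖E₁‖ + ‖E₂‖ + ‖E₃‖ + ‖E₄‖ := by
    rw [← norm_mul, hEJ]
    refine (norm_sub_le _ _).trans ?_
    refine add_le_add ((norm_add_le _ _).trans (add_le_add (norm_sub_le _ _) ?_)) ?_ <;> simp
  have := mul_le_mul_of_nonneg_left low (norm_nonneg (Ψ 0))
  linarith

namespace BeurlingSystem

variable (S : BeurlingSystem)

lemma one_le_n (j : ℕ) : 1 ≤ S.n j := by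
  obtain ⟨k, rfl⟩ := S.equiv.surjective j
  rw [S.n_eq]
  refine Finset.one_le_prod fun i _ => one_le_pow₀ ?_
  exact S.one_lt_p.le.trans (S.mono_p (Nat.zero_le i))

lemma Nint_eq_zero {x : ℝ} (hx : x < 1) : S.Nint x = 0 := by
  have : {j : ℕ | S.n j ≤ x} = ∅ :=
    Set.eq_empty_of_forall_notMem fun j hj => absurd (S.one_le_n j) (not_le.2 (hj.trans_lt hx))
  rw [Nint, this, Set.ncard_empty]

variable {S} {θ A : ℝ}

lemma eventually_finite_and_le (hθ1 : θ < 1) (hA : 0 < A)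
    (hwb : (fun x : ℝ => (S.Nint x : ℝ) - A * x) =O[atTop] fun x : ℝ => x ^ θ) :
    ∀ᶠ x : ℝ in atTop, {j : ℕ | S.n j ≤ x}.Finite ∧ (S.Nint x : ℝ) ≤ 2 * A * x := by
  have h1 : (fun x : ℝ => x ^ θ) =o[atTop] fun x : ℝ => x := by
    refine isLittleO_of_tendsto' ?_ ((tendsto_rpow_neg_atTop (sub_pos.2 hθ1)).congr' ?_)
    · filter_upwards [eventually_gt_atTop 0] with x hx h0
      exact absurd h0 hx.ne'
    · filter_upwards [eventually_gt_atTop 0] with x hx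
      rw [neg_sub, Real.rpow_sub_one hx.ne']
  filter_upwards [(hwb.trans_isLittleO h1).bound (half_pos hA), eventually_gt_atTop 0] with x hx hx0
  rw [Real.norm_eq_abs, Real.norm_eq_abs, abs_of_pos hx0, abs_le] at hx
  have hAx := mul_pos hA hx0
  refine ⟨Set.finite_of_ncard_pos ?_, by linarith [hx.2]⟩
  have : (0 : ℝ) < S.Nint x := by linarith [hx.1]
  exact_mod_cast this

lemma finite_n_le (hθ1 : θ < 1) (hA : 0 < A)
    (hwb : (fun x : ℝ => (S.Nint x : ℝ) - A * x) =O[atTop] fun x : ℝ => x ^ θ) (x : ℝ) :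
    {j : ℕ | S.n j ≤ x}.Finite := by
  obtain ⟨y, hy, hxy⟩ :=
    ((eventually_finite_and_le hθ1 hA hwb).and (eventually_ge_atTop x)).exists
  exact hy.1.subset fun j hj => le_trans hj hxy

lemma Nint_mono (hfin : ∀ x, {j : ℕ | S.n j ≤ x}.Finite) : Monotone S.Nint := fun _ y hxy =>
  Set.ncard_le_ncard (fun _ hj => le_trans hj hxy) (hfin y)

lemma summable_n_rpow (hθ1 : θ < 1) (hA : 0 < A)
    (hwb : (fun x : ℝ => (S.Nint x : ℝ) - A * x) =O[atTop] fun x : ℝ => x ^ θ)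
    {σ : ℝ} (hσ : 1 < σ) : Summable fun j => S.n j ^ (-σ) := by
  have hfin := finite_n_le hθ1 hA hwb
  obtain ⟨X, hX⟩ := eventually_atTop.1 (eventually_finite_and_le hθ1 hA hwb)
  have hs : Summable fun j : ℕ => (2 * A) ^ σ * ((j + 1 : ℕ) : ℝ) ^ (-σ) :=
    ((summable_nat_add_iff 1).2 (Real.summable_nat_rpow.2 (by linarith))).mul_left _
  refine hs.of_norm_bounded_eventually_nat ?_
  have hev : ∀ᶠ j : ℕ in atTop, j ∉ {j : ℕ | S.n j ≤ X} := by
    rw [← Nat.cofinite_eq_atTop]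
    exact (hfin X).eventually_cofinite_notMem
  filter_upwards [hev] with j hj
  have hnX : X ≤ S.n j := (not_le.1 hj).le
  have hn0 : 0 < S.n j := zero_lt_one.trans_le (S.one_le_n j)
  have hcard : ((j + 1 : ℕ) : ℝ) ≤ 2 * A * S.n j := by
    refine le_trans ?_ (hX _ hnX).2
    have : ((Finset.range (j + 1) : Finset ℕ) : Set ℕ).ncard ≤ S.Nint (S.n j) :=
      Set.ncard_le_ncard (fun i hi => S.mono_n (by
        simpa [Nat.lt_succ_iff] using hi)) (hfin _)
    rw [Set.ncard_coe_finset, Finset.card_range] at this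
    exact_mod_cast this
  have hj0 : (0 : ℝ) < ((j + 1 : ℕ) : ℝ) := by positivity
  rw [Real.norm_of_nonneg (by positivity), Real.rpow_neg hn0.le, Real.rpow_neg hj0.le,
    ← div_eq_mul_inv, inv_le_comm₀ (by positivity) (by positivity), inv_div,
    ← Real.div_rpow (by positivity) (by positivity)]
  refine Real.rpow_le_rpow (by positivity) ?_ (by linarith)
  rw [div_le_iff₀ (by positivity)]
  linarith

/-- The error term `N(x) - A x`, truncated to `x ≥ 1`. -/
noncomputable def err (S : BeurlingSystem) (A x : ℝ) : ℂ :=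
  (S.Nint x : ℂ) - (Set.Ici 1).indicator (fun x : ℝ => ((A * x : ℝ) : ℂ)) x

lemma err_eq_zero {x : ℝ} (hx : x < 1) : S.err A x = 0 := by
  simp [err, S.Nint_eq_zero hx, hx]

lemma err_locallyIntegrableOn (hfin : ∀ x, {j : ℕ | S.n j ≤ x}.Finite) :
    MeasureTheory.LocallyIntegrableOn (S.err A) (Set.Ioi 0) := by
  have h1 : MeasureTheory.LocallyIntegrable (fun x => ((S.Nint x : ℝ) : ℂ)) := by
    have hm : Monotone fun x => (S.Nint x : ℝ) := fun x y h =>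
      Nat.cast_le.2 (Nint_mono hfin h)
    intro x
    obtain ⟨u, hu, hi⟩ := hm.locallyIntegrable (μ := MeasureTheory.volume) x
    exact ⟨u, hu, hi.ofReal⟩
  have h2 : MeasureTheory.LocallyIntegrable
      ((Set.Ici 1).indicator fun x : ℝ => ((A * x : ℝ) : ℂ)) :=
    (Continuous.locallyIntegrable (by fun_prop)).indicator measurableSet_Ici
  exact (h1.sub h2).locallyIntegrableOn _

lemma err_isBigO_atTop
    (hwb : (fun x : ℝ => (S.Nint x : ℝ) - A * x) =O[atTop] fun x : ℝ => x ^ θ) :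
    S.err A =O[atTop] fun x : ℝ => x ^ (-(-θ)) := by
  rw [neg_neg]
  refine IsBigO.congr' (Complex.isBigO_ofReal_left.2 hwb) ?_ EventuallyEq.rfl
  filter_upwards [eventually_ge_atTop 1] with x hx
  simp [err, hx]

lemma err_isBigO_zero (b : ℝ) :
    S.err A =O[nhdsWithin 0 (Set.Ioi 0)] fun x : ℝ => x ^ (-b) := by
  refine IsBigO.congr' (isBigO_zero _ _) ?_ EventuallyEq.rfl
  filter_upwards [nhdsWithin_le_nhds (eventually_lt_nhds one_pos)] with x hx
  exact (err_eq_zero hx).symm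

lemma err_mellinConvergent (hfin : ∀ x, {j : ℕ | S.n j ≤ x}.Finite)
    (hwb : (fun x : ℝ => (S.Nint x : ℝ) - A * x) =O[atTop] fun x : ℝ => x ^ θ)
    {s : ℂ} (hs : θ < s.re) : MellinConvergent (S.err A) (-s) :=
  mellinConvergent_of_isBigO_rpow (err_locallyIntegrableOn hfin) (err_isBigO_atTop hwb)
    (by simpa using hs) (err_isBigO_zero (-s.re - 1)) (by simp)

lemma differentiableAt_mellin_err (hfin : ∀ x, {j : ℕ | S.n j ≤ x}.Finite)
    (hwb : (fun x : ℝ => (S.Nint x : ℝ) - A * x) =O[atTop] fun x : ℝ => x ^ θ)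
    {s : ℂ} (hs : θ < s.re) : DifferentiableAt ℂ (fun s => mellin (S.err A) (-s)) s :=
  DifferentiableAt.comp (g := mellin (S.err A)) s
    (mellin_differentiableAt_of_isBigO_rpow (err_locallyIntegrableOn hfin) (err_isBigO_atTop hwb)
      (by simpa using hs) (err_isBigO_zero (-s.re - 1)) (by simp)) differentiable_neg.differentiableAt

lemma norm_mellin_err_le (hfin : ∀ x, {j : ℕ | S.n j ≤ x}.Finite)
    (hwb : (fun x : ℝ => (S.Nint x : ℝ) - A * x) =O[atTop] fun x : ℝ => x ^ θ)
    {σ : ℝ} (hσ : θ < σ) :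
    ∃ D : ℝ, ∀ s : ℂ, σ ≤ s.re → ‖mellin (S.err A) (-s)‖ ≤ D := by
  have hint := (err_mellinConvergent (s := (σ : ℂ)) hfin hwb (by simpa using hσ)).norm
  refine ⟨_, fun s hs => MeasureTheory.norm_integral_le_of_norm_le hint ?_⟩
  refine (MeasureTheory.ae_restrict_iff' measurableSet_Ioi).2 (Eventually.of_forall fun x hx => ?_)
  rcases lt_or_ge x 1 with h1 | h1
  · simp [err_eq_zero h1]
  · rw [norm_smul, norm_smul, Complex.norm_cpow_eq_rpow_re_of_pos hx,
      Complex.norm_cpow_eq_rpow_re_of_pos hx]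
    refine mul_le_mul_of_nonneg_right (Real.rpow_le_rpow_of_exponent_le h1 ?_) (norm_nonneg _)
    simpa using hs

open MeasureTheory in
/-- The Dirichlet series as a Mellin transform of the error term. -/
lemma tsum_eq_mellin_err (hθ1 : θ < 1) (hA : 0 < A)
    (hwb : (fun x : ℝ => (S.Nint x : ℝ) - A * x) =O[atTop] fun x : ℝ => x ^ θ)
    {s : ℂ} (hs : 1 < s.re) :
    ∑' j : ℕ, (S.n j : ℂ) ^ (-s) = s * mellin (S.err A) (-s) + A + A / (s - 1) := by
  have hfin := finite_n_le hθ1 hA hwb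
  have hs0 : s ≠ 0 := by rintro rfl; norm_num at hs
  have hs1 : s - 1 ≠ 0 := by
    intro h
    rw [sub_eq_zero.1 h] at hs
    norm_num at hs
  have hre : (-s - 1).re < -1 := by simp; linarith
  have hn0 : ∀ j, 0 < S.n j := fun j => zero_lt_one.trans_le (S.one_le_n j)
  have hinter : ∀ c : ℝ, 0 < c → Set.Ioi 0 ∩ Set.Ici c = Set.Ici c := fun c hc =>
    Set.inter_eq_right.2 fun x hx => hc.trans_le hx
  let F : ℕ → ℝ → ℂ := fun j => (Set.Ici (S.n j)).indicator fun x => (x : ℂ) ^ (-s - 1)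
  have hFint : ∀ j, Integrable (F j) (volume.restrict (Set.Ioi 0)) := by
    intro j
    refine (IntegrableOn.integrable_indicator ?_ measurableSet_Ici).integrableOn
    exact (integrableOn_Ici_iff_integrableOn_Ioi).2 (integrableOn_Ioi_cpow_of_lt hre (hn0 j))
  have hFval : ∀ j, ∫ x in Set.Ioi 0, F j x = (S.n j : ℂ) ^ (-s) / s := by
    intro j
    rw [setIntegral_indicator measurableSet_Ici, hinter _ (hn0 j), integral_Ici_eq_integral_Ioi,
      integral_Ioi_cpow_of_lt hre (hn0 j), sub_add_cancel, neg_div_neg_eq]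
  have hFnorm : ∀ j, ∫ x in Set.Ioi 0, ‖F j x‖ = S.n j ^ (-s.re) / s.re := by
    intro j
    have : ∀ x, ‖F j x‖ = (Set.Ici (S.n j)).indicator (fun x => ‖(x : ℂ) ^ (-s - 1)‖) x :=
      fun x => norm_indicator_eq_indicator_norm _ _
    simp_rw [this]
    rw [setIntegral_indicator measurableSet_Ici, hinter _ (hn0 j), integral_Ici_eq_integral_Ioi,
      setIntegral_congr_fun (g := fun x : ℝ => x ^ (-s.re - 1)) measurableSet_Ioi fun x hx => by
        simp [Complex.norm_cpow_eq_rpow_re_of_pos ((hn0 j).trans hx)],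
      integral_Ioi_rpow_of_lt (by linarith) (hn0 j), sub_add_cancel, neg_div_neg_eq]
  have hsum := hasSum_integral_of_summable_integral_norm hFint (by
    simp_rw [hFnorm]
    exact (summable_n_rpow hθ1 hA hwb hs).div_const _)
  have hFtsum : ∀ x, ∑' j, F j x = (x : ℂ) ^ (-s - 1) * S.Nint x := by
    intro x
    rw [tsum_eq_sum (s := (hfin x).toFinset) fun j hj => by
      simp only [F]
      exact Set.indicator_of_notMem (by simpa using hj) _]
    rw [Finset.sum_congr rfl (g := fun _ => (x : ℂ) ^ (-s - 1)) fun j hj => by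
      simp only [F]
      exact Set.indicator_of_mem (by simpa using hj) _]
    rw [Finset.sum_const, nsmul_eq_mul, mul_comm, Nint, Set.ncard_eq_toFinset_card _ (hfin x)]
  simp_rw [hFtsum, hFval] at hsum
  let G : ℝ → ℂ := (Set.Ici 1).indicator fun x : ℝ => (A : ℂ) * (x : ℂ) ^ (-s)
  have hre' : (-s).re < -1 := by simpa using hs
  have hGint : Integrable G (volume.restrict (Set.Ioi 0)) := by
    refine (IntegrableOn.integrable_indicator ?_ measurableSet_Ici).integrableOn
    exact (integrableOn_Ici_iff_integrableOn_Ioi).2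
      ((integrableOn_Ioi_cpow_of_lt hre' one_pos).const_mul _)
  have hGval : ∫ x in Set.Ioi 0, G x = A / (s - 1) := by
    rw [setIntegral_indicator measurableSet_Ici, hinter _ one_pos, integral_Ici_eq_integral_Ioi,
      integral_const_mul, integral_Ioi_cpow_of_lt hre' one_pos, Complex.ofReal_one,
      Complex.one_cpow, show -s + 1 = -(s - 1) by ring, neg_div_neg_eq, mul_one_div]
  have hsplit : ∫ x in Set.Ioi (0 : ℝ), (x : ℂ) ^ (-s - 1) * S.Nint x
      = mellin (S.err A) (-s) + A / (s - 1) := by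
    rw [← hGval, mellin, ← integral_add (err_mellinConvergent hfin hwb (hθ1.trans hs)) hGint]
    refine setIntegral_congr_fun measurableSet_Ioi fun x hx => ?_
    have hx0 : (x : ℂ) ≠ 0 := Complex.ofReal_ne_zero.2 (ne_of_gt hx)
    by_cases h1 : x ∈ Set.Ici (1 : ℝ)
    · simp only [G, err, Set.indicator_of_mem h1, smul_eq_mul]
      rw [Complex.cpow_sub _ _ hx0, Complex.cpow_one]
      push_cast
      field_simp
      ring
    · simp only [G, err, Set.indicator_of_notMem h1, smul_eq_mul]
      ring
  rw [hsplit] at hsum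
  have h := (hsum.mul_left s).tsum_eq
  simp_rw [mul_div_cancel₀ _ hs0] at h
  rw [h]
  field_simp
  ring

/-- Growth of the regular part of the zeta function. -/
lemma norm_sub_pole_le (hθ1 : θ < 1) (hA : 0 < A)
    (hwb : (fun x : ℝ => (S.Nint x : ℝ) - A * x) =O[atTop] fun x : ℝ => x ^ θ)
    {Z : ℂ → ℂ} (hZ : S.IsZeta θ A Z) {σ : ℝ} (hσ : θ < σ) :
    ∃ D : ℝ, 0 ≤ D ∧ ∀ s : ℂ, σ ≤ s.re → ‖Z s - A / (s - 1)‖ ≤ D * (1 + ‖s‖) := by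
  have hfin := finite_n_le hθ1 hA hwb
  have hopen : IsOpen {s : ℂ | θ < s.re} := isOpen_lt continuous_const Complex.continuous_re
  have hconv : Convex ℝ {s : ℂ | θ < s.re} := convex_halfSpace_re_gt θ
  have heq : Set.EqOn (fun s => Z s - A / (s - 1)) (fun s => s * mellin (S.err A) (-s) + A)
      {s : ℂ | θ < s.re} := by
    refine AnalyticOnNhd.eqOn_of_preconnected_of_eventuallyEq (hZ.2.analyticOnNhd hopen)
      (DifferentiableOn.analyticOnNhd (fun s hs => ?_) hopen) hconv.isPreconnected (z₀ := 2)
      (by simp; linarith) ?_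
    · exact ((differentiableAt_id.mul (differentiableAt_mellin_err hfin hwb hs)).add_const
        _).differentiableWithinAt
    · have : {s : ℂ | 1 < s.re} ∈ nhds (2 : ℂ) :=
        (isOpen_lt continuous_const Complex.continuous_re).mem_nhds (by simp)
      filter_upwards [this] with s hs
      rw [hZ.1 s hs, tsum_eq_mellin_err hθ1 hA hwb hs, add_sub_cancel_right]
  obtain ⟨D, hD⟩ := norm_mellin_err_le hfin hwb hσ
  have hD0 : 0 ≤ D := (norm_nonneg _).trans (hD σ (by simp))
  refine ⟨D + A, by positivity, fun s hs => ?_⟩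
  have := heq (hσ.trans_le hs)
  simp only at this
  rw [this]
  calc ‖s * mellin (S.err A) (-s) + A‖ ≤ ‖s‖ * D + A := by
        refine (norm_add_le _ _).trans (add_le_add ?_ ?_)
        · rw [norm_mul]
          exact mul_le_mul_of_nonneg_left (hD s hs) (norm_nonneg _)
        · rw [Complex.norm_real, Real.norm_of_nonneg hA.le]
    _ ≤ (D + A) * (1 + ‖s‖) := by nlinarith [norm_nonneg s, mul_nonneg hA.le (norm_nonneg s)]

/-- The zeta function is bounded on `Re s ≥ 2`. -/
lemma norm_zeta_le (hθ1 : θ < 1) (hA : 0 < A)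
    (hwb : (fun x : ℝ => (S.Nint x : ℝ) - A * x) =O[atTop] fun x : ℝ => x ^ θ)
    {Z : ℂ → ℂ} (hZ : S.IsZeta θ A Z) :
    ∃ B : ℝ, 0 ≤ B ∧ ∀ s : ℂ, 2 ≤ s.re → ‖Z s‖ ≤ B := by
  have hsum := summable_n_rpow hθ1 hA hwb one_lt_two
  refine ⟨∑' j, S.n j ^ (-2 : ℝ), tsum_nonneg fun j =>
    Real.rpow_nonneg (zero_le_one.trans (S.one_le_n j)) _, fun s hs => ?_⟩
  rw [hZ.1 s (one_lt_two.trans_le hs)]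
  refine tsum_of_norm_bounded hsum.hasSum fun j => ?_
  rw [Complex.norm_cpow_eq_rpow_re_of_pos (zero_lt_one.trans_le (S.one_le_n j))]
  exact Real.rpow_le_rpow_of_exponent_le (S.one_le_n j) (by simpa using hs)

end BeurlingSystem

/-- Removing the pole of the zeta function by the factor `(s - 1) / (s + 1)`. -/
lemma BeurlingSystem.exists_regularization {S : BeurlingSystem} {θ A : ℝ} (hθ0 : 0 ≤ θ)
    (hθ1 : θ < 1) (hA : 0 < A)
    (hwb : (fun x : ℝ => (S.Nint x : ℝ) - A * x) =O[atTop] fun x : ℝ => x ^ θ)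
    {Z : ℂ → ℂ} (hZ : S.IsZeta θ A Z) {σ c : ℝ} (hσ : θ < σ) (hc : 0 < c) :
    ∃ (g : ℂ → ℂ) (D : ℝ), DifferentiableOn ℂ g {s | θ < s.re} ∧ 0 ≤ D ∧
      (∀ s : ℂ, σ ≤ s.re → ‖g s‖ ≤ D * (1 + ‖s‖)) ∧
      (∀ s : ℂ, σ ≤ s.re → s ≠ 1 → ‖g s‖ ≤ ‖Z s‖) ∧
      (∀ s : ℂ, σ ≤ s.re → s.re ≤ 1 - c → ‖Z s‖ ≤ (1 + 2 / c) * ‖g s‖) := by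
  obtain ⟨D, hD0, hD⟩ := BeurlingSystem.norm_sub_pole_le hθ1 hA hwb hZ hσ
  have hne : ∀ s : ℂ, 0 ≤ s.re → s + 1 ≠ 0 := fun s hs h => by
    have := congrArg Complex.re h
    simp at this
    linarith
  have hle : ∀ s : ℂ, 0 ≤ s.re → ‖s - 1‖ ≤ ‖s + 1‖ := fun s hs => by
    rw [← sq_le_sq₀ (norm_nonneg _) (norm_nonneg _), ← Complex.normSq_eq_norm_sq,
      ← Complex.normSq_eq_norm_sq, Complex.normSq_apply, Complex.normSq_apply]
    simp
    nlinarith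
  have hone : ∀ s : ℂ, 0 ≤ s.re → 1 ≤ ‖s + 1‖ := fun s hs => by
    refine le_trans ?_ (Complex.re_le_norm _)
    simpa using hs
  have heq : ∀ s : ℂ, s ≠ 1 →
      ((Z s - A / (s - 1)) * (s - 1) + A) / (s + 1) = Z s * (s - 1) / (s + 1) := fun s hs => by
    have := sub_ne_zero.2 hs
    congr 1
    field_simp
    ring
  refine ⟨fun s => ((Z s - A / (s - 1)) * (s - 1) + A) / (s + 1), D + A, ?_, by positivity,
    fun s hs => ?_, fun s hs h1 => ?_, fun s hs hsc => ?_⟩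
  · exact ((hZ.2.mul (by fun_prop)).add_const _).div (by fun_prop)
      fun s hs => hne s (hθ0.trans (le_of_lt hs))
  · have hs0 : 0 ≤ s.re := by linarith
    rw [norm_div, div_le_iff₀ (zero_lt_one.trans_le (hone s hs0))]
    refine (norm_add_le _ _).trans ?_
    rw [norm_mul, Complex.norm_real, Real.norm_of_nonneg hA.le]
    have h1 : ‖Z s - A / (s - 1)‖ * ‖s - 1‖ ≤ D * (1 + ‖s‖) * ‖s + 1‖ :=
      mul_le_mul (hD s hs) (hle s hs0) (norm_nonneg _) (by positivity)
    have h2 : A * 1 ≤ A * ((1 + ‖s‖) * ‖s + 1‖) :=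
      mul_le_mul_of_nonneg_left (one_le_mul_of_one_le_of_one_le (by simp) (hone s hs0)) hA.le
    linarith
  · have hs0 : 0 ≤ s.re := by linarith
    simp only [heq s h1]
    rw [norm_div, norm_mul, div_le_iff₀ (zero_lt_one.trans_le (hone s hs0))]
    exact mul_le_mul_of_nonneg_left (hle s hs0) (norm_nonneg _)
  · have hs0 : 0 ≤ s.re := by linarith
    have hcs : c ≤ ‖s - 1‖ := by
      refine le_trans ?_ (Complex.abs_re_le_norm _)
      refine le_trans ?_ (neg_le_abs _)
      simp
      linarith
    have h1 : s ≠ 1 := by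
      rintro rfl
      simp at hcs
      linarith
    have hs1 : 0 < ‖s + 1‖ := zero_lt_one.trans_le (hone s hs0)
    simp only [heq s h1]
    rw [norm_div, norm_mul, ← mul_div_assoc, le_div_iff₀ hs1]
    have h2 : ‖s + 1‖ ≤ (1 + 2 / c) * ‖s - 1‖ := by
      have h3 : ‖s + 1‖ ≤ ‖s - 1‖ + 2 := by
        have := norm_add_le (s - 1) 2
        rw [show s - 1 + 2 = s + 1 by ring] at this
        simpa using this
      have h4 : 2 / c * c ≤ 2 / c * ‖s - 1‖ := mul_le_mul_of_nonneg_left hcs (by positivity)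
      rw [div_mul_cancel₀ _ hc.ne'] at h4
      linarith
    calc ‖Z s‖ * ‖s + 1‖ ≤ ‖Z s‖ * ((1 + 2 / c) * ‖s - 1‖) :=
          mul_le_mul_of_nonneg_left h2 (norm_nonneg _)
      _ = _ := by ring

lemma integral_exp_neg_sq_le {V : ℝ} (hV : 0 ≤ V) :
    ∫ y in -V..V, Real.exp (-y ^ 2) ≤ √Real.pi := by
  have h := integral_gaussian 1
  have hi := integrable_exp_neg_mul_sq one_pos
  simp only [neg_one_mul, div_one] at h hi
  rw [intervalIntegral.integral_of_le (by linarith), ← h]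
  exact MeasureTheory.setIntegral_le_integral hi (Eventually.of_forall fun y => by positivity)

lemma intervalIntegral_le_of_le {a b : ℝ} (hab : a ≤ b) {f h : ℝ → ℝ}
    (hle : ∀ x ∈ Set.Icc a b, |f x| ≤ h x) (hh : IntervalIntegrable h MeasureTheory.volume a b) :
    ∫ x in a..b, f x ≤ ∫ x in a..b, h x :=
  (Real.le_norm_self _).trans (intervalIntegral.norm_integral_le_of_norm_le hab
    (Eventually.of_forall fun x hx => hle x (Set.Ioc_subset_Icc_self hx)) hh)

lemma norm_pow_mul_cexp_sq (z w : ℂ) (m : ℕ) :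
    ‖z ^ m * Complex.exp (w ^ 2)‖ = ‖z‖ ^ m * Real.exp (w.re ^ 2 - w.im ^ 2) := by
  rw [norm_mul, norm_pow, Complex.norm_exp, pow_two w, Complex.mul_re, pow_two, pow_two]

/-- Linear growth of `g` is killed by the factor `exp (w ^ 2)` at height `log T`. -/
lemma norm_pow_mul_cexp_sq_le {z w : ℂ} {D V : ℝ} (m : ℕ) (hz : ‖z‖ ≤ D * Real.exp V)
    (hre : w.re ^ 2 ≤ 4) (him : w.im ^ 2 = V ^ 2) :
    ‖z ^ m * Complex.exp (w ^ 2)‖ ≤ D ^ m * Real.exp (4 + (m : ℝ) ^ 2) := by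
  have hD : 0 ≤ D := by
    by_contra! h
    nlinarith [norm_nonneg z, Real.exp_pos V]
  rw [norm_pow_mul_cexp_sq, him]
  calc _ ≤ (D * Real.exp V) ^ m * Real.exp (4 - V ^ 2) :=
        mul_le_mul (pow_le_pow_left₀ (norm_nonneg _) hz m)
          (Real.exp_le_exp.2 (by linarith)) (Real.exp_nonneg _) (by positivity)
    _ = D ^ m * Real.exp (m * V + (4 - V ^ 2)) := by
        rw [mul_pow, ← Real.exp_nat_mul, Real.exp_add]; ring
    _ ≤ D ^ m * Real.exp (4 + (m : ℝ) ^ 2) := by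
        refine mul_le_mul_of_nonneg_left (Real.exp_le_exp.2 ?_) (by positivity)
        nlinarith [sq_nonneg ((m : ℝ) - V), sq_nonneg (m : ℝ), sq_nonneg V]

/-- A power of a holomorphic function of linear growth, bounded far to the right, is bounded
at distance `1 / V` from a vertical line by a weighted mean over that line. -/
lemma norm_pow_le_weighted_mean {θ σ D B : ℝ} (hσ0 : 0 ≤ σ) (hσ1 : σ ≤ 1) (hσ : θ < σ)
    {g : ℂ → ℂ} (hg : DifferentiableOn ℂ g {s | θ < s.re}) (hD : 0 ≤ D)
    (hgD : ∀ s : ℂ, σ ≤ s.re → ‖g s‖ ≤ D * (1 + ‖s‖))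
    (hgB : ∀ s : ℂ, 2 ≤ s.re → ‖g s‖ ≤ B) (m : ℕ) {V t : ℝ} (hV : 4 ≤ V)
    (ht : |t| ≤ Real.exp V) :
    ‖g (((σ + 1 / V : ℝ) : ℂ) + Complex.I * (t : ℂ))‖ ^ m ≤
      5 / 4 * (6 * ((D * 6) ^ m * Real.exp (4 + (m : ℝ) ^ 2)) + B ^ m * Real.exp 4 * √Real.pi
        + Real.exp 2 * (V * ∫ v in -V..V,
          ‖g ((σ : ℂ) + Complex.I * (t : ℂ) + Complex.I * (v : ℂ))‖ ^ m * Real.exp (-|v|))) := by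
  have hV0 : 0 < V := by linarith
  have hB : 0 ≤ B := (norm_nonneg _).trans (hgB 2 (by simp))
  have hVδ : (1 / V)⁻¹ = V := by rw [one_div, inv_inv]
  have hδ0 : 0 < 1 / V := by positivity
  have hδ1 : 1 / V ≤ 1 := by
    rw [div_le_iff₀ hV0]
    linarith
  generalize 1 / V = δ at *
  obtain ⟨s₀, hs₀⟩ : ∃ s₀ : ℂ, s₀ = ((σ + δ : ℝ) : ℂ) + Complex.I * (t : ℂ) := ⟨_, rfl⟩
  have hs₀re : s₀.re = σ + δ := by simp [hs₀]
  have hs₀im : s₀.im = t := by simp [hs₀]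
  have hΨ : DifferentiableOn ℂ (fun w => g (s₀ + w) ^ m * Complex.exp (w ^ 2))
      {w | θ < (s₀ + w).re} := by
    have hcomp : DifferentiableOn ℂ (fun w => g (s₀ + w)) {w | θ < (s₀ + w).re} :=
      hg.comp (g := g) (f := fun w => s₀ + w) (by fun_prop) fun w hw => hw
    refine (hcomp.pow m).mul ?_
    exact (by fun_prop : Differentiable ℂ fun w : ℂ => Complex.exp (w ^ 2)).differentiableOn
  have hopen : IsOpen {w : ℂ | θ < (s₀ + w).re} := isOpen_lt (by fun_prop) (by fun_prop)
  have key := norm_le_rect_integrals hopen hΨ hδ0 (by linarith : 1 ≤ V) (fun w hw => by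
    have : -δ ≤ w.re := hw
    simp only [Set.mem_ofPred_eq, Complex.add_re, hs₀re]
    linarith)
  have hor : ∀ c : ℝ, |c| = V →
      ∫ x in -δ..2, ‖g (s₀ + ((x : ℂ) + (c : ℂ) * Complex.I)) ^ m
        * Complex.exp (((x : ℂ) + (c : ℂ) * Complex.I) ^ 2)‖
      ≤ 3 * ((D * 6) ^ m * Real.exp (4 + (m : ℝ) ^ 2)) := by
    intro c hc
    refine (intervalIntegral_le_of_le (by linarith) (fun x hx => ?_)
      intervalIntegrable_const).trans (b := ∫ x in -δ..2, (D * 6) ^ m * Real.exp (4 + (m : ℝ) ^ 2))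
      ?_
    · have hre : (s₀ + ((x : ℂ) + (c : ℂ) * Complex.I)).re = σ + δ + x := by
        simp [hs₀re]
      have him : (s₀ + ((x : ℂ) + (c : ℂ) * Complex.I)).im = t + c := by
        simp [hs₀im]
      have hwre : ((x : ℂ) + (c : ℂ) * Complex.I).re = x := by simp
      have hwim : ((x : ℂ) + (c : ℂ) * Complex.I).im = c := by simp
      rw [abs_norm]
      refine norm_pow_mul_cexp_sq_le (V := V) m ?_ (by rw [hwre]; nlinarith [hx.1, hx.2])
        (by rw [hwim, ← hc, sq_abs])
      refine (hgD _ (by rw [hre]; linarith [hx.1])).trans ?_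
      rw [mul_assoc]
      refine mul_le_mul_of_nonneg_left ?_ hD
      have hn := Complex.norm_le_abs_re_add_abs_im (s₀ + ((x : ℂ) + (c : ℂ) * Complex.I))
      rw [hre, him, abs_of_nonneg (by linarith [hx.1])] at hn
      linarith [abs_add_le t c, hx.2, Real.add_one_le_exp V]
    · rw [intervalIntegral.integral_const, smul_eq_mul]
      exact mul_le_mul_of_nonneg_right (by linarith) (by positivity)
  have h₁ := hor (-V) (by rw [abs_neg, abs_of_pos hV0])
  have h₂ := hor V (abs_of_pos hV0)
  have h₃ : ∫ y in -V..V, ‖g (s₀ + (((2 : ℝ) : ℂ) + (y : ℂ) * Complex.I)) ^ m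
        * Complex.exp ((((2 : ℝ) : ℂ) + (y : ℂ) * Complex.I) ^ 2)‖
      ≤ B ^ m * Real.exp 4 * √Real.pi := by
    refine (intervalIntegral_le_of_le (by linarith) (fun y hy => ?_)
      (Continuous.intervalIntegrable (by fun_prop) _ _)).trans
      (b := ∫ y in -V..V, B ^ m * Real.exp 4 * Real.exp (-y ^ 2)) ?_
    · have hre : (s₀ + (((2 : ℝ) : ℂ) + (y : ℂ) * Complex.I)).re = σ + δ + 2 := by
        simp [hs₀re]
      have hwre : (((2 : ℝ) : ℂ) + (y : ℂ) * Complex.I).re = 2 := by simp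
      have hwim : (((2 : ℝ) : ℂ) + (y : ℂ) * Complex.I).im = y := by simp
      rw [abs_norm, norm_pow_mul_cexp_sq, hwre, hwim, mul_assoc, ← Real.exp_add]
      exact mul_le_mul (pow_le_pow_left₀ (norm_nonneg _) (hgB _ (by rw [hre]; linarith)) m)
        (Real.exp_le_exp.2 (by linarith)) (Real.exp_nonneg _) (by positivity)
    · rw [intervalIntegral.integral_const_mul]
      exact mul_le_mul_of_nonneg_left (integral_exp_neg_sq_le hV0.le) (by positivity)
  have hline : Continuous fun v : ℝ => g ((σ : ℂ) + Complex.I * (t : ℂ) + Complex.I * (v : ℂ)) :=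
    hg.continuousOn.comp_continuous (by fun_prop) fun v => by simpa using hσ
  have h₄ : ∫ y in -V..V, ‖g (s₀ + (((-δ : ℝ) : ℂ) + (y : ℂ) * Complex.I)) ^ m
        * Complex.exp ((((-δ : ℝ) : ℂ) + (y : ℂ) * Complex.I) ^ 2)‖
      ≤ Real.exp 2 * ∫ v in -V..V,
        ‖g ((σ : ℂ) + Complex.I * (t : ℂ) + Complex.I * (v : ℂ))‖ ^ m * Real.exp (-|v|) := by
    rw [← intervalIntegral.integral_const_mul]
    refine intervalIntegral_le_of_le (by linarith) (fun y hy => ?_)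
      ((((hline.norm.pow m).mul (by fun_prop)).const_mul _).intervalIntegrable _ _)
    have hs : s₀ + (((-δ : ℝ) : ℂ) + (y : ℂ) * Complex.I)
        = (σ : ℂ) + Complex.I * (t : ℂ) + Complex.I * (y : ℂ) := by
      rw [hs₀]; push_cast; ring
    have hwre : (((-δ : ℝ) : ℂ) + (y : ℂ) * Complex.I).re = -δ := by simp
    have hwim : (((-δ : ℝ) : ℂ) + (y : ℂ) * Complex.I).im = y := by simp
    rw [abs_norm, norm_pow_mul_cexp_sq, hwre, hwim, hs, mul_left_comm, ← Real.exp_add]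
    refine mul_le_mul_of_nonneg_left (Real.exp_le_exp.2 ?_) (by positivity)
    have : (-δ) ^ 2 ≤ 1 := by nlinarith
    nlinarith [sq_abs y, sq_nonneg (|y| - 1)]
  rw [hVδ] at key
  have h₄' := mul_le_mul_of_nonneg_left h₄ hV0.le
  have h0 : ‖g (s₀ + 0) ^ m * Complex.exp (0 ^ 2)‖ = ‖g s₀‖ ^ m := by simp
  rw [h0] at key
  rw [← hs₀]
  linarith

/-- Ivić's lemma (Lemma 5.4): for `2k` a positive integer, the value
`|ζ_𝒫((1+θ)/2 + 1/log T + it)|^{2k}` is bounded by a short average of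
`|ζ_𝒫((1+θ)/2 + it + iv)|^{2k}` over `|v| ≤ Z/2` with `Z = C₂ log T`. -/
theorem ivic_lemma
    (θ : ℝ) (hθ0 : 0 ≤ θ) (hθ1 : θ < 1) (S : BeurlingSystem)
    (A : ℝ) (hA : 0 < A)
    (hwb : (fun x : ℝ => (S.Nint x : ℝ) - A * x) =O[atTop] fun x : ℝ => x ^ θ)
    (Z : ℂ → ℂ) (hZ : S.IsZeta θ A Z)
    (k : ℝ) (hk0 : 0 < k) (hk : ∃ m : ℕ, 0 < m ∧ (m : ℝ) = 2 * k) :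
    ∃ C₂ C T₁ : ℝ, ∀ T : ℝ, T₁ ≤ T → ∀ t : ℝ, |t| ≤ T →
      ‖Z ((((1 + θ) / 2 + 1 / Real.log T : ℝ) : ℂ) + Complex.I * (t : ℂ))‖ ^ (2 * k)
        ≤ C * (1 + Real.log T *
            ∫ v in (-(C₂ * Real.log T) / 2)..(C₂ * Real.log T) / 2,
              ‖Z ((((1 + θ) / 2 : ℝ) : ℂ) + Complex.I * (t : ℂ) + Complex.I * (v : ℂ))‖ ^ (2 * k)
                * Real.exp (-|v|)) := by
  obtain ⟨m, -, hmk⟩ := hk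
  rw [← hmk]
  simp only [Real.rpow_natCast]
  have hσ : θ < (1 + θ) / 2 := by linarith
  obtain ⟨c, hc⟩ : ∃ c : ℝ, c = (1 - θ) / 4 := ⟨_, rfl⟩
  have hc0 : 0 < c := by linarith
  obtain ⟨g, D, hg, hD0, hgD, hgZ, hZg⟩ :=
    BeurlingSystem.exists_regularization hθ0 hθ1 hA hwb hZ hσ hc0
  obtain ⟨B, hB0, hB⟩ := BeurlingSystem.norm_zeta_le hθ1 hA hwb hZ
  have hgB : ∀ s : ℂ, 2 ≤ s.re → ‖g s‖ ≤ B := fun s hs =>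
    (hgZ s (by linarith) (by rintro rfl; norm_num at hs)).trans (hB s hs)
  obtain ⟨K, hK⟩ : ∃ K : ℝ, K = 6 * ((D * 6) ^ m * Real.exp (4 + (m : ℝ) ^ 2))
    + B ^ m * Real.exp 4 * √Real.pi := ⟨_, rfl⟩
  have hK0 : 0 ≤ K := by rw [hK]; positivity
  refine ⟨2, (1 + 2 / c) ^ m * (5 / 4) * (K + Real.exp 2), Real.exp (1 / c), fun T hT t ht => ?_⟩
  have hT0 : 0 < T := (Real.exp_pos _).trans_le hT
  have hVc : 1 / c ≤ Real.log T := (Real.le_log_iff_exp_le hT0).2 hT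
  rw [← Real.exp_log hT0] at ht
  generalize Real.log T = V at *
  have hV4 : 4 ≤ V := by
    refine le_trans ?_ hVc
    rw [le_div_iff₀ hc0]
    linarith
  have hV0 : 0 < V := by linarith
  have hδ : 1 / V ≤ c := by
    rw [div_le_iff₀ hV0]
    rw [div_le_iff₀ hc0] at hVc
    linarith
  have hδ0 : 0 < 1 / V := by positivity
  rw [show -(2 * V) / 2 = -V by ring, show 2 * V / 2 = V by ring]
  have hre : ∀ v : ℝ, ((((1 + θ) / 2 : ℝ) : ℂ) + Complex.I * (t : ℂ) + Complex.I * (v : ℂ)).re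
      = (1 + θ) / 2 := fun v => by simp
  have hne : ∀ v : ℝ, (((1 + θ) / 2 : ℝ) : ℂ) + Complex.I * (t : ℂ) + Complex.I * (v : ℂ) ≠ 1 :=
    fun v h => by
      have := hre v
      rw [h, Complex.one_re] at this
      linarith
  have hZline : Continuous fun v : ℝ =>
      Z ((((1 + θ) / 2 : ℝ) : ℂ) + Complex.I * (t : ℂ) + Complex.I * (v : ℂ)) := by
    have hH := hZ.2.continuousOn.comp_continuous (f := fun v : ℝ =>
      (((1 + θ) / 2 : ℝ) : ℂ) + Complex.I * (t : ℂ) + Complex.I * (v : ℂ)) (by fun_prop)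
      fun v => hσ.trans_eq (hre v).symm
    have hP : Continuous fun v : ℝ => (A : ℂ) /
        ((((1 + θ) / 2 : ℝ) : ℂ) + Complex.I * (t : ℂ) + Complex.I * (v : ℂ) - 1) :=
      Continuous.div (by fun_prop) (by fun_prop) fun v => sub_ne_zero.2 (hne v)
    exact (hH.add hP).congr fun v => sub_add_cancel _ _
  have hJ : ∫ v in -V..V,
      ‖g ((((1 + θ) / 2 : ℝ) : ℂ) + Complex.I * (t : ℂ) + Complex.I * (v : ℂ))‖ ^ m
        * Real.exp (-|v|) ≤ ∫ v in -V..V,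
      ‖Z ((((1 + θ) / 2 : ℝ) : ℂ) + Complex.I * (t : ℂ) + Complex.I * (v : ℂ))‖ ^ m
        * Real.exp (-|v|) := by
    refine intervalIntegral_le_of_le (by linarith) (fun v _ => ?_)
      (((hZline.norm.pow m).mul (by fun_prop)).intervalIntegrable _ _)
    rw [abs_of_nonneg (by positivity)]
    exact mul_le_mul_of_nonneg_right (pow_le_pow_left₀ (norm_nonneg _)
      (hgZ _ (hre v).ge (hne v)) m) (Real.exp_nonneg _)
  have hJ0 : 0 ≤ ∫ v in -V..V,
      ‖Z ((((1 + θ) / 2 : ℝ) : ℂ) + Complex.I * (t : ℂ) + Complex.I * (v : ℂ))‖ ^ m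
        * Real.exp (-|v|) :=
    intervalIntegral.integral_nonneg (by linarith) fun v _ => by positivity
  have hmean := norm_pow_le_weighted_mean (by linarith) (by linarith) hσ hg hD0 hgD hgB m hV4 ht
  rw [← hK] at hmean
  have hs₀ : ((((1 + θ) / 2 + 1 / V : ℝ) : ℂ) + Complex.I * (t : ℂ)).re
      = (1 + θ) / 2 + 1 / V := by simp
  have hZs := hZg (((((1 + θ) / 2 + 1 / V : ℝ) : ℂ) + Complex.I * (t : ℂ)))
    (by rw [hs₀]; linarith) (by rw [hs₀]; linarith)
  generalize (((1 + θ) / 2 + 1 / V : ℝ) : ℂ) + Complex.I * (t : ℂ) = s₀ at *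
  generalize (∫ v in -V..V,
    ‖Z ((((1 + θ) / 2 : ℝ) : ℂ) + Complex.I * (t : ℂ) + Complex.I * (v : ℂ))‖ ^ m
      * Real.exp (-|v|)) = J at *
  calc ‖Z s₀‖ ^ m ≤ ((1 + 2 / c) * ‖g s₀‖) ^ m := pow_le_pow_left₀ (norm_nonneg _) hZs m
    _ = (1 + 2 / c) ^ m * ‖g s₀‖ ^ m := mul_pow _ _ _
    _ ≤ (1 + 2 / c) ^ m * (5 / 4 * ((K + Real.exp 2) * (1 + V * J))) := by
        refine mul_le_mul_of_nonneg_left (hmean.trans ?_) (by positivity)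
        have h1 := mul_le_mul_of_nonneg_left hJ (mul_pos (Real.exp_pos 2) hV0).le
        have h2 := mul_nonneg hK0 (mul_nonneg hV0.le hJ0)
        linarith [Real.exp_pos 2]
    _ = _ := by ring
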